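/- arXiv:1408.5268 — 3 statements merged into one kernel-verified Lean document; each statement's English description precedes it below -/
import Mathlib

section
/- Let a, b be complex numbers that are not nonpositive integers with Re(a+b) > 0 (so c = a+b), and let n be a positive integer. Then S_n(a,b;a+b) = ∑_{k=0}^{n-1} (a)_k(b)_k/((a+b)_k k!) equals [Γ(n+a)Γ(n+b)Γ(a+b)/(Γ(n)Γ(n+a+b)Γ(a)Γ(b))] · ∑_{k=0}^∞ [(a)_k (b)_k / ((n+a+b)_k k!)] · {ψ(n+a+b+k) + ψ(1+k) − ψ(a+k) − ψ(b+k)}, where ψ is the digamma function. -/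
/-- The Pochhammer (rising factorial) symbol `(x)_k` for complex `x`. -/
noncomputable def cpoch (x : ℂ) (k : ℕ) : ℂ := ∏ i ∈ Finset.range k, (x + i)

/-- The digamma function `ψ = Γ'/Γ` on `ℂ`. -/
noncomputable def cdigamma (z : ℂ) : ℂ := deriv Complex.Gamma z / Complex.Gamma z

open Filter Topology

lemma re_pos_ne {s : ℂ} (hs : 0 < s.re) (m : ℕ) : s ≠ -(m : ℂ) := by
  intro h
  rw [h] at hs
  simp at hs
  have : (0:ℝ) ≤ m := Nat.cast_nonneg m
  linarith

lemma real_gammaSeq_le {x : ℝ} (hx : 0 < x) {n : ℕ} (hn : n ≠ 0) :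
    (n : ℝ) ^ x * (n.factorial : ℝ) / ∏ j ∈ Finset.range (n + 1), (x + j) ≤ Real.Gamma x := by
  have h := Real.BohrMollerup.ge_logGammaSeq (f := Real.log ∘ Real.Gamma) (x := x) (n := n)
    Real.convexOn_log_Gamma
    (fun {y} hy => by
      simp only [Function.comp]
      rw [Real.Gamma_add_one hy.ne', Real.log_mul hy.ne' (Real.Gamma_pos_of_pos hy).ne', add_comm])
    hx hn
  have hn' : (0:ℝ) < n := by exact_mod_cast Nat.pos_of_ne_zero hn
  have hp : ∀ j ∈ Finset.range (n+1), x + (j:ℝ) ≠ 0 := fun j _ => by positivity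
  have hpp : 0 < ∏ j ∈ Finset.range (n + 1), (x + (j:ℝ)) := Finset.prod_pos fun j _ => by positivity
  rw [← Real.log_le_log_iff (by positivity) (Real.Gamma_pos_of_pos hx)]
  rw [Real.log_div (by positivity) hpp.ne', Real.log_mul (by positivity) (by positivity),
    Real.log_rpow hn', Real.log_prod hp]
  simpa [Real.BohrMollerup.logGammaSeq, Function.comp] using h

lemma norm_gammaSeq_le {s : ℂ} (hs : 0 < s.re) {n : ℕ} (hn : n ≠ 0) :
    ‖Complex.GammaSeq s n‖ ≤ Real.Gamma s.re := by
  refine le_trans ?_ (real_gammaSeq_le hs hn)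
  rw [Complex.GammaSeq, norm_div, norm_mul,
    Complex.norm_natCast_cpow_of_pos (Nat.pos_of_ne_zero hn), norm_prod, Complex.norm_natCast]
  gcongr with j hj
  have := Complex.re_le_norm (s + j)
  simpa using this

lemma differentiableOn_gammaSeq {n : ℕ} (hn : n ≠ 0) :
    DifferentiableOn ℂ (fun s => Complex.GammaSeq s n) {s : ℂ | 0 < s.re} := by
  intro s hs
  apply DifferentiableAt.differentiableWithinAt
  unfold Complex.GammaSeq
  have h1 : ∏ j ∈ Finset.range (n + 1), (s + (j:ℂ)) ≠ 0 :=
    Finset.prod_ne_zero_iff.2 fun j _ h => re_pos_ne hs j (by linear_combination h)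
  have hn' : (n:ℂ) ≠ 0 := by exact_mod_cast hn
  refine DifferentiableAt.div ?_ ?_ h1
  · exact (DifferentiableAt.const_cpow differentiableAt_id (Or.inl hn')).mul_const _
  · fun_prop

lemma tendsto_deriv_gammaSeq {s : ℂ} (hs : 0 < s.re) :
    Tendsto (fun n : ℕ => deriv (fun z => Complex.GammaSeq z n) s) atTop
      (𝓝 (deriv Complex.Gamma s)) := by
  have hU : IsOpen {s : ℂ | 0 < s.re} := isOpen_lt continuous_const Complex.continuous_re
  obtain ⟨R, hR, hball⟩ := Metric.nhds_basis_closedBall.mem_iff.1 (hU.mem_nhds hs)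
  have hmem : s ∈ Metric.ball s R := Metric.mem_ball_self hR
  have hG : DifferentiableOn ℂ Complex.Gamma {s : ℂ | 0 < s.re} := fun z hz =>
    (Complex.differentiableAt_Gamma z (re_pos_ne hz)).differentiableWithinAt
  have hcirc : ∀ θ, circleMap s R θ ∈ {s : ℂ | 0 < s.re} := fun θ =>
    hball (circleMap_mem_closedBall s hR.le θ)
  rw [← Complex.two_pi_I_inv_smul_circleIntegral_sub_sq_inv_smul_of_differentiable hU hball hG hmem]
  have hev : ∀ᶠ n : ℕ in atTop, (2 * ↑Real.pi * Complex.I)⁻¹ • (∮ (z : ℂ) in C(s, R),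
      ((z - s) ^ 2)⁻¹ • Complex.GammaSeq z n) = deriv (fun z => Complex.GammaSeq z n) s := by
    filter_upwards [eventually_ne_atTop 0] with n hn
    exact Complex.two_pi_I_inv_smul_circleIntegral_sub_sq_inv_smul_of_differentiable hU hball
      (differentiableOn_gammaSeq hn) hmem
  refine Tendsto.congr' hev ?_
  refine Tendsto.const_smul ?_ _
  unfold circleIntegral
  have hker : Continuous fun θ : ℝ => ((circleMap s R θ - s) ^ 2)⁻¹ := by
    refine Continuous.inv₀ (by fun_prop) fun θ => ?_
    have : circleMap s R θ - s ≠ 0 := sub_ne_zero.2 (circleMap_ne_center hR.ne')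
    exact pow_ne_zero _ this
  have hder : Continuous fun θ : ℝ => deriv (circleMap s R) θ := by
    simp only [deriv_circleMap]; fun_prop
  have hbd : Continuous fun θ : ℝ => Real.Gamma (circleMap s R θ).re := by
    rw [continuous_iff_continuousAt]
    intro θ
    have h1 : ContinuousAt Real.Gamma (circleMap s R θ).re := by
      apply (Real.differentiableAt_Gamma _).continuousAt
      intro m h
      have h2 : 0 < (circleMap s R θ).re := hcirc θ
      have : (0:ℝ) ≤ m := Nat.cast_nonneg m
      linarith
    exact ContinuousAt.comp (f := fun θ : ℝ => (circleMap s R θ).re) h1 (by fun_prop)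
  refine intervalIntegral.tendsto_integral_filter_of_dominated_convergence
    (fun θ => ‖deriv (circleMap s R) θ‖ * (‖((circleMap s R θ - s) ^ 2)⁻¹‖ *
      Real.Gamma (circleMap s R θ).re)) ?_ ?_ ?_ ?_
  · filter_upwards [eventually_ne_atTop 0] with n hn
    have hc : Continuous fun θ : ℝ => Complex.GammaSeq (circleMap s R θ) n :=
      (differentiableOn_gammaSeq hn).continuousOn.comp_continuous (by fun_prop) hcirc
    exact (hder.smul (hker.smul hc)).aestronglyMeasurable
  · filter_upwards [eventually_ne_atTop 0] with n hn
    refine Eventually.of_forall fun θ _ => ?_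
    rw [norm_smul, norm_smul]
    gcongr
    exact norm_gammaSeq_le (hcirc θ) hn
  · exact ((hder.norm).mul (hker.norm.mul hbd)).intervalIntegrable _ _
  · refine Eventually.of_forall fun θ _ => ?_
    exact ((Complex.GammaSeq_tendsto_Gamma _).const_smul _).const_smul _

lemma cdigamma_add_one {s : ℂ} (hs : ∀ m : ℕ, s ≠ -(m:ℂ)) :
    cdigamma (s + 1) = cdigamma s + s⁻¹ := Complex.digamma_apply_add_one s hs

lemma ne_neg_add {s : ℂ} (hs : ∀ m : ℕ, s ≠ -(m:ℂ)) (k : ℕ) : ∀ m : ℕ, s + k ≠ -(m:ℂ) := by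
  intro m h
  refine hs (m + k) ?_
  push_cast
  linear_combination h

lemma cdigamma_add_nat {s : ℂ} (hs : ∀ m : ℕ, s ≠ -(m:ℂ)) (n : ℕ) :
    cdigamma (s + n) = cdigamma s + ∑ j ∈ Finset.range n, (s + j)⁻¹ := by
  induction n with
  | zero => simp
  | succ n ih =>
    rw [Finset.sum_range_succ, ← add_assoc, ← ih, ← cdigamma_add_one (ne_neg_add hs n)]
    push_cast
    rw [add_assoc]

lemma logDeriv_gammaSeq {s : ℂ} (hs : 0 < s.re) {n : ℕ} (hn : n ≠ 0) :
    deriv (fun z => Complex.GammaSeq z n) s / Complex.GammaSeq s n =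
      Complex.log n + cdigamma s - cdigamma (s + n + 1) := by
  have hne := re_pos_ne hs
  have hn' : (n:ℂ) ≠ 0 := by exact_mod_cast hn
  have hj : ∀ j ∈ Finset.range (n + 1), s + (j:ℂ) ≠ 0 :=
    fun j _ h => hne j (by linear_combination h)
  have hp : ∏ j ∈ Finset.range (n + 1), (s + (j:ℂ)) ≠ 0 := Finset.prod_ne_zero_iff.2 hj
  have hf : (n.factorial : ℂ) ≠ 0 := by exact_mod_cast n.factorial_ne_zero
  have hc : (n:ℂ) ^ s ≠ 0 := by simp [Complex.cpow_eq_zero_iff, hn']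
  have hd : HasDerivAt (fun z : ℂ => (n:ℂ) ^ z) ((n:ℂ) ^ s * Complex.log n) s := by
    simpa using (hasDerivAt_id s).const_cpow (Or.inl hn')
  have h1 := cdigamma_add_nat hne (n + 1)
  have h2 : s + n + 1 = s + ((n + 1 : ℕ) : ℂ) := by push_cast; ring
  rw [h2, h1]
  have key : logDeriv (fun z => Complex.GammaSeq z n) s =
      Complex.log n - ∑ j ∈ Finset.range (n+1), (s + j)⁻¹ := by
    unfold Complex.GammaSeq
    rw [logDeriv_div (f := fun z : ℂ => (n:ℂ) ^ z * (n.factorial : ℂ))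
      (g := fun z : ℂ => ∏ j ∈ Finset.range (n + 1), (z + (j:ℂ))) s (mul_ne_zero hc hf) hp
      (hd.differentiableAt.mul_const _) (by fun_prop)]
    congr 1
    · rw [logDeriv_apply, (hd.mul_const _).deriv]
      field_simp
    · rw [logDeriv_prod hj (fun j _ => by fun_prop)]
      refine Finset.sum_congr rfl fun j _ => ?_
      rw [logDeriv_apply]
      simp
  rw [logDeriv_apply] at key
  rw [key]
  ring

lemma tendsto_cdigamma_re_pos {s : ℂ} (hs : 0 < s.re) :
    Tendsto (fun n : ℕ => cdigamma (s + n + 1) - Complex.log n) atTop (𝓝 0) := by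
  have h := (tendsto_deriv_gammaSeq hs).div (Complex.GammaSeq_tendsto_Gamma s)
    (Complex.Gamma_ne_zero (re_pos_ne hs))
  have h2 : Tendsto (fun n : ℕ => cdigamma s -
      deriv (fun z => Complex.GammaSeq z n) s / Complex.GammaSeq s n) atTop
      (𝓝 (cdigamma s - deriv Complex.Gamma s / Complex.Gamma s)) := tendsto_const_nhds.sub h
  rw [show cdigamma s - deriv Complex.Gamma s / Complex.Gamma s = 0 from sub_self _] at h2
  refine h2.congr' ?_
  filter_upwards [eventually_ne_atTop 0] with n hn
  rw [logDeriv_gammaSeq hs hn]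
  ring

lemma tendsto_inv_add_nat (z : ℂ) : Tendsto (fun n : ℕ => (z + n)⁻¹) atTop (𝓝 0) := by
  have h : Tendsto (fun n : ℕ => ‖z + n‖) atTop atTop := by
    refine tendsto_atTop_mono (f := fun n : ℕ => z.re + n) (fun n => ?_)
      (tendsto_atTop_add_const_left _ _ tendsto_natCast_atTop_atTop)
    simpa using Complex.re_le_norm (z + n)
  exact tendsto_inv₀_cobounded.comp (tendsto_norm_atTop_iff_cobounded.1 h)

lemma tendsto_cdigamma {z : ℂ} (hz : ∀ m : ℕ, z ≠ -(m:ℂ)) :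
    Tendsto (fun n : ℕ => cdigamma (z + n) - Complex.log n) atTop (𝓝 0) := by
  obtain ⟨N, hN⟩ := exists_nat_gt (-z.re)
  have hs : 0 < (z + N).re := by simp; linarith
  have h := tendsto_cdigamma_re_pos hs
  have hsum : Tendsto (fun n : ℕ => ∑ j ∈ Finset.range (N + 1), (z + j + n)⁻¹) atTop (𝓝 0) := by
    have := tendsto_finsetSum (Finset.range (N + 1))
      (fun j _ => tendsto_inv_add_nat (z + j))
    simpa using this
  have h3 := h.sub hsum
  rw [sub_zero] at h3
  refine h3.congr fun n => ?_
  have h4 := cdigamma_add_nat (ne_neg_add hz n) (N + 1)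
  have h5 : z + N + n + 1 = z + n + ((N + 1 : ℕ) : ℂ) := by push_cast; ring
  rw [h5, h4]
  have h6 : ∀ j : ℕ, z + (j:ℂ) + n = z + n + j := fun j => by ring
  simp only [h6]
  ring

lemma cpoch_succ (x : ℂ) (k : ℕ) : cpoch x (k + 1) = cpoch x k * (x + k) :=
  Finset.prod_range_succ _ _

lemma cpoch_succ_left (x : ℂ) (k : ℕ) : cpoch (x + 1) k * x = cpoch x k * (x + k) := by
  induction k with
  | zero => simp [cpoch]
  | succ k ih =>
    rw [cpoch_succ, cpoch_succ]
    push_cast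
    linear_combination (x + 1 + k) * ih

lemma add_nat_ne {x : ℂ} (hx : ∀ m : ℕ, x ≠ -(m:ℂ)) (k : ℕ) : x + (k:ℂ) ≠ 0 :=
  fun h => hx k (by linear_combination h)

lemma cpoch_ne_zero {x : ℂ} (hx : ∀ m : ℕ, x ≠ -(m:ℂ)) (k : ℕ) : cpoch x k ≠ 0 :=
  Finset.prod_ne_zero_iff.2 fun j _ => add_nat_ne hx j

lemma Gamma_add_nat_cpoch {x : ℂ} (hx : ∀ m : ℕ, x ≠ -(m:ℂ)) (k : ℕ) :
    Complex.Gamma ((k:ℂ) + x) = cpoch x k * Complex.Gamma x := by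
  induction k with
  | zero => simp [cpoch]
  | succ k ih =>
    have h : ((k + 1 : ℕ) : ℂ) + x = (k:ℂ) + x + 1 := by push_cast; ring
    rw [h, Complex.Gamma_add_one _ (by rw [add_comm]; exact add_nat_ne hx k), ih, cpoch_succ]
    ring

/-- The hypergeometric term with denominator parameter `c`. -/
noncomputable def uTerm (a b c : ℂ) (k : ℕ) : ℂ :=
  cpoch a k * cpoch b k / (cpoch c k * (Nat.factorial k : ℂ))

/-- The digamma combination. -/
noncomputable def hTerm (a b c : ℂ) (k : ℕ) : ℂ :=
  cdigamma (c + k) + cdigamma (1 + k) - cdigamma (a + k) - cdigamma (b + k)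

lemma fact_ne (k : ℕ) : (k.factorial : ℂ) ≠ 0 := by exact_mod_cast k.factorial_ne_zero

lemma succ_ne (k : ℕ) : (k : ℂ) + 1 ≠ 0 := by exact_mod_cast k.succ_ne_zero

lemma uTerm_succ (a b c : ℂ) (hc : ∀ m : ℕ, c ≠ -(m:ℂ)) (k : ℕ) :
    uTerm a b c (k + 1) = uTerm a b c k * ((a + k) * (b + k) / ((c + k) * (k + 1))) := by
  unfold uTerm
  rw [cpoch_succ, cpoch_succ, cpoch_succ, Nat.factorial_succ]
  have h1 := cpoch_ne_zero hc k
  have h2 := add_nat_ne hc k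
  have h3 := fact_ne k
  have h4 := succ_ne k
  push_cast
  field_simp

lemma uTerm_add_one (a b c : ℂ) (hc : ∀ m : ℕ, c ≠ -(m:ℂ)) (k : ℕ) :
    uTerm a b (c + 1) k = uTerm a b c k * (c / (c + k)) := by
  unfold uTerm
  have hc0 : c ≠ 0 := by simpa using hc 0
  have h1 := cpoch_ne_zero hc k
  have h2 := add_nat_ne hc k
  have h3 := fact_ne k
  have h4 : cpoch (c + 1) k = cpoch c k * (c + k) / c := by
    rw [eq_div_iff hc0, cpoch_succ_left]
  rw [h4]
  field_simp

lemma one_ne_neg (m : ℕ) : (1:ℂ) ≠ -(m:ℂ) := re_pos_ne (by simp) m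

lemma hTerm_succ {a b c : ℂ} (ha : ∀ m : ℕ, a ≠ -(m:ℂ)) (hb : ∀ m : ℕ, b ≠ -(m:ℂ))
    (hc : ∀ m : ℕ, c ≠ -(m:ℂ)) (k : ℕ) :
    hTerm a b c (k + 1) = hTerm a b c k + (c + k)⁻¹ + (1 + (k:ℂ))⁻¹ - (a + k)⁻¹ - (b + k)⁻¹ := by
  unfold hTerm
  push_cast
  simp only [← add_assoc]
  rw [cdigamma_add_one (ne_neg_add ha k), cdigamma_add_one (ne_neg_add hb k),
    cdigamma_add_one (ne_neg_add hc k), cdigamma_add_one (ne_neg_add one_ne_neg k)]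
  ring

lemma hTerm_add_one {a b c : ℂ} (hc : ∀ m : ℕ, c ≠ -(m:ℂ)) (k : ℕ) :
    hTerm a b (c + 1) k = hTerm a b c k + (c + k)⁻¹ := by
  unfold hTerm
  rw [show c + 1 + (k:ℂ) = c + k + 1 by ring, cdigamma_add_one (ne_neg_add hc k)]
  ring

lemma tendsto_hTerm {a b c : ℂ} (ha : ∀ m : ℕ, a ≠ -(m:ℂ)) (hb : ∀ m : ℕ, b ≠ -(m:ℂ))
    (hc : ∀ m : ℕ, c ≠ -(m:ℂ)) : Tendsto (hTerm a b c) atTop (𝓝 0) := by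
  have h := (((tendsto_cdigamma hc).add (tendsto_cdigamma one_ne_neg)).sub
    (tendsto_cdigamma ha)).sub (tendsto_cdigamma hb)
  simp only [add_zero, sub_zero] at h
  refine h.congr fun k => ?_
  unfold hTerm
  ring

/-- The telescoping identity (WZ pair), one step. -/
lemma wz_step {a b : ℂ} (ha : ∀ m : ℕ, a ≠ -(m:ℂ)) (hb : ∀ m : ℕ, b ≠ -(m:ℂ))
    (n : ℕ) (hc : ∀ m : ℕ, (n:ℂ) + a + b ≠ -(m:ℂ)) (k : ℕ) :
    (a + n) * (b + n) / (a + b + n) *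
        (uTerm a b ((n:ℂ) + a + b + 1) k * hTerm a b ((n:ℂ) + a + b + 1) k)
      - n * (uTerm a b ((n:ℂ) + a + b) k * hTerm a b ((n:ℂ) + a + b) k)
    = (1 - k * hTerm a b ((n:ℂ) + a + b) k) * uTerm a b ((n:ℂ) + a + b) k
      - (1 - (k + 1 : ℕ) * hTerm a b ((n:ℂ) + a + b) (k + 1))
        * uTerm a b ((n:ℂ) + a + b) (k + 1) := by
  rw [uTerm_succ _ _ _ hc, uTerm_add_one _ _ _ hc, hTerm_succ ha hb hc, hTerm_add_one hc]
  generalize uTerm a b ((n:ℂ) + a + b) k = u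
  generalize hTerm a b ((n:ℂ) + a + b) k = h
  have h1 := add_nat_ne ha k
  have h2 := add_nat_ne hb k
  have h3 := add_nat_ne hc k
  have h4 := add_nat_ne one_ne_neg k
  have h5 := succ_ne k
  have h6 : (n:ℂ) + a + b ≠ 0 := by simpa using hc 0
  have h7 : a + b + (n:ℂ) ≠ 0 := by rwa [show a + b + (n:ℂ) = n + a + b by ring]
  push_cast
  rw [show a + b + (n:ℂ) = n + a + b by ring, add_comm (1:ℂ) k]
  field_simp
  ring

lemma wz_sum {a b : ℂ} (ha : ∀ m : ℕ, a ≠ -(m:ℂ)) (hb : ∀ m : ℕ, b ≠ -(m:ℂ))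
    (n : ℕ) (hc : ∀ m : ℕ, (n:ℂ) + a + b ≠ -(m:ℂ)) (K : ℕ) :
    (a + n) * (b + n) / (a + b + n) * ∑ k ∈ Finset.range K,
        (uTerm a b ((n:ℂ) + a + b + 1) k * hTerm a b ((n:ℂ) + a + b + 1) k)
      - n * ∑ k ∈ Finset.range K, (uTerm a b ((n:ℂ) + a + b) k * hTerm a b ((n:ℂ) + a + b) k)
    = 1 - (1 - K * hTerm a b ((n:ℂ) + a + b) K) * uTerm a b ((n:ℂ) + a + b) K := by
  rw [Finset.mul_sum, Finset.mul_sum, ← Finset.sum_sub_distrib,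
    Finset.sum_congr rfl fun k _ => wz_step ha hb n hc k,
    Finset.sum_range_sub' (fun k : ℕ => (1 - k * hTerm a b ((n:ℂ) + a + b) k) *
      uTerm a b ((n:ℂ) + a + b) k)]
  simp [uTerm, cpoch]

lemma tendsto_mul_uTerm_zero {a b : ℂ} (ha : ∀ m : ℕ, a ≠ -(m:ℂ)) (hb : ∀ m : ℕ, b ≠ -(m:ℂ))
    (hab : 0 < (a + b).re) :
    ∃ l : ℂ, Tendsto (fun k : ℕ => (k:ℂ) * uTerm a b (a + b) k) atTop (𝓝 l) := by
  refine ⟨Complex.Gamma (a + b) / (Complex.Gamma a * Complex.Gamma b), ?_⟩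
  rw [← tendsto_add_atTop_iff_nat 1]
  have h := (Complex.GammaSeq_tendsto_Gamma (a + b)).div
    ((Complex.GammaSeq_tendsto_Gamma a).mul (Complex.GammaSeq_tendsto_Gamma b))
    (mul_ne_zero (Complex.Gamma_ne_zero ha) (Complex.Gamma_ne_zero hb))
  refine h.congr' ?_
  filter_upwards [eventually_ne_atTop 0] with k hk
  have hk' : (k:ℂ) ≠ 0 := by exact_mod_cast hk
  have e : ∀ s, Complex.GammaSeq s k = (k:ℂ) ^ s * (k.factorial : ℂ) / cpoch s (k + 1) :=
    fun s => rfl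
  simp only [Pi.div_apply]
  rw [e, e, e, Complex.cpow_add _ _ hk', uTerm, Nat.factorial_succ]
  have hca : (k:ℂ) ^ a ≠ 0 := by simp [Complex.cpow_eq_zero_iff, hk']
  have hcb : (k:ℂ) ^ b ≠ 0 := by simp [Complex.cpow_eq_zero_iff, hk']
  have h1 := cpoch_ne_zero ha (k + 1)
  have h2 := cpoch_ne_zero hb (k + 1)
  have h3 := cpoch_ne_zero (re_pos_ne hab) (k + 1)
  have h4 := fact_ne k
  have h5 := succ_ne k
  push_cast
  field_simp

lemma natc_ne {a b : ℂ} (hab : 0 < (a + b).re) (n : ℕ) :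
    ∀ m : ℕ, (n:ℂ) + a + b ≠ -(m:ℂ) := by
  apply re_pos_ne
  have : (0:ℝ) ≤ n := Nat.cast_nonneg n
  simp at hab ⊢
  linarith

lemma cast_succ_c (a b : ℂ) (n : ℕ) : ((n + 1 : ℕ) : ℂ) + a + b = (n:ℂ) + a + b + 1 := by
  push_cast; ring

lemma tendsto_mul_uTerm {a b : ℂ} (ha : ∀ m : ℕ, a ≠ -(m:ℂ)) (hb : ∀ m : ℕ, b ≠ -(m:ℂ))
    (hab : 0 < (a + b).re) (n : ℕ) :
    ∃ l : ℂ, Tendsto (fun k : ℕ => (k:ℂ) * uTerm a b ((n:ℂ) + a + b) k) atTop (𝓝 l) := by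
  induction n with
  | zero => simpa using tendsto_mul_uTerm_zero ha hb hab
  | succ n ih =>
    obtain ⟨l, hl⟩ := ih
    refine ⟨l * (((n:ℂ) + a + b) * 0), ?_⟩
    refine (hl.mul ((tendsto_inv_add_nat ((n:ℂ) + a + b)).const_mul ((n:ℂ) + a + b))).congr
      fun k => ?_
    rw [cast_succ_c, uTerm_add_one _ _ _ (natc_ne hab n), div_eq_mul_inv]
    ring

lemma tendsto_uTerm {a b : ℂ} (ha : ∀ m : ℕ, a ≠ -(m:ℂ)) (hb : ∀ m : ℕ, b ≠ -(m:ℂ))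
    (hab : 0 < (a + b).re) (n : ℕ) :
    Tendsto (fun k : ℕ => uTerm a b ((n:ℂ) + a + b) k) atTop (𝓝 0) := by
  obtain ⟨l, hl⟩ := tendsto_mul_uTerm ha hb hab n
  have h := hl.mul (tendsto_inv_add_nat 0)
  rw [mul_zero] at h
  refine h.congr' ?_
  filter_upwards [eventually_ne_atTop 0] with k hk
  have hk' : (k:ℂ) ≠ 0 := by exact_mod_cast hk
  rw [zero_add]
  field_simp

lemma summable_terms {a b : ℂ} (ha : ∀ m : ℕ, a ≠ -(m:ℂ)) (hb : ∀ m : ℕ, b ≠ -(m:ℂ))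
    (hab : 0 < (a + b).re) (n : ℕ) :
    Summable fun k : ℕ => uTerm a b (((n + 1 : ℕ):ℂ) + a + b) k *
      hTerm a b (((n + 1 : ℕ):ℂ) + a + b) k := by
  obtain ⟨l, hl⟩ := tendsto_mul_uTerm ha hb hab n
  have hh := tendsto_hTerm ha hb (natc_ne hab (n + 1))
  have hc := natc_ne hab n
  have hi := tendsto_inv_add_nat ((n:ℂ) + a + b)
  have hlim := ((hl.mul_const ((n:ℂ) + a + b)).mul
    ((hi.const_mul ((n:ℂ) + a + b)).const_sub 1)).mul hh
  refine summable_of_isBigO_nat (g := fun k : ℕ => ((k:ℝ) ^ 2)⁻¹)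
    (Real.summable_nat_pow_inv.2 one_lt_two) ?_
  have hbd := hlim.isBigO_one ℝ
  have hsq : (fun k : ℕ => ((k:ℂ) ^ 2)⁻¹) =O[atTop] (fun k : ℕ => ((k:ℝ) ^ 2)⁻¹) :=
    Asymptotics.IsBigO.of_bound 1 (by simp)
  have h2 := hbd.mul hsq
  simp only [one_mul] at h2
  refine h2.congr' ?_ EventuallyEq.rfl
  filter_upwards [eventually_ne_atTop 0] with k hk
  have hk' : (k:ℂ) ≠ 0 := by exact_mod_cast hk
  have h3 := add_nat_ne hc k
  rw [cast_succ_c, uTerm_add_one _ _ _ hc]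
  generalize hTerm a b ((n:ℂ) + a + b + 1) k = h
  generalize uTerm a b ((n:ℂ) + a + b) k = u
  field_simp
  ring

lemma tendsto_partial {a b : ℂ} (ha : ∀ m : ℕ, a ≠ -(m:ℂ)) (hb : ∀ m : ℕ, b ≠ -(m:ℂ))
    (hab : 0 < (a + b).re) (n : ℕ) :
    Tendsto (fun K : ℕ => n * uTerm a b (a + b) n * ∑ k ∈ Finset.range K,
      (uTerm a b ((n:ℂ) + a + b) k * hTerm a b ((n:ℂ) + a + b) k)) atTop
      (𝓝 (∑ k ∈ Finset.range n, uTerm a b (a + b) k)) := by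
  induction n with
  | zero => simp
  | succ n ih =>
    rw [Finset.sum_range_succ]
    obtain ⟨l, hl⟩ := tendsto_mul_uTerm ha hb hab n
    have hu := tendsto_uTerm ha hb hab n
    have hc := natc_ne hab n
    have hh := tendsto_hTerm ha hb hc
    have h1 := ih.add (((hu.sub (hl.mul hh)).const_sub 1).const_mul (uTerm a b (a + b) n))
    simp only [mul_zero, sub_zero, mul_one] at h1
    refine h1.congr fun K => ?_
    have hw := wz_sum ha hb n hc K
    rw [uTerm_succ _ _ _ (re_pos_ne hab), cast_succ_c]
    have h5 := succ_ne n
    have h7 : a + b + (n:ℂ) ≠ 0 := add_nat_ne (re_pos_ne hab) n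
    have e : ((n + 1 : ℕ) : ℂ) * (uTerm a b (a + b) n *
        ((a + n) * (b + n) / ((a + b + n) * (n + 1)))) =
        uTerm a b (a + b) n * ((a + n) * (b + n) / (a + b + n)) := by
      push_cast
      field_simp
    rw [e]
    linear_combination (-uTerm a b (a + b) n) * hw

/-- The logarithmic case `s = c - a - b = 0`: Watson-type convergent expansion for the
partial sum `S_n(a,b;a+b)`. -/
theorem partial_sum_excess_zero (a b : ℂ)
    (ha : ∀ j : ℕ, a ≠ -(j : ℂ)) (hb : ∀ j : ℕ, b ≠ -(j : ℂ)) (hab : 0 < (a + b).re)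
    (n : ℕ) (hn : 0 < n) :
    ∑ k ∈ Finset.range n,
        cpoch a k * cpoch b k / (cpoch (a + b) k * (Nat.factorial k : ℂ))
      = Complex.Gamma ((n : ℂ) + a) * Complex.Gamma ((n : ℂ) + b) * Complex.Gamma (a + b) /
          (Complex.Gamma (n : ℂ) * Complex.Gamma ((n : ℂ) + a + b) *
            Complex.Gamma a * Complex.Gamma b) *
        ∑' k : ℕ, cpoch a k * cpoch b k / (cpoch ((n : ℂ) + a + b) k * (Nat.factorial k : ℂ)) *
          (cdigamma ((n : ℂ) + a + b + k) + cdigamma (1 + k) -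
            cdigamma (a + k) - cdigamma (b + k)) := by
  have hab' := re_pos_ne hab
  obtain ⟨m, rfl⟩ : ∃ m, n = m + 1 := ⟨n - 1, by omega⟩
  have h1 := tendsto_partial ha hb hab (m + 1)
  have h2 := ((summable_terms ha hb hab m).hasSum.tendsto_sum_nat).const_mul
    (((m + 1 : ℕ) : ℂ) * uTerm a b (a + b) (m + 1))
  have h3 := tendsto_nhds_unique h1 h2
  have hP : Complex.Gamma (((m + 1 : ℕ) : ℂ) + a) * Complex.Gamma (((m + 1 : ℕ) : ℂ) + b) *
      Complex.Gamma (a + b) / (Complex.Gamma ((m + 1 : ℕ) : ℂ) *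
        Complex.Gamma (((m + 1 : ℕ) : ℂ) + a + b) * Complex.Gamma a * Complex.Gamma b) =
      ((m + 1 : ℕ) : ℂ) * uTerm a b (a + b) (m + 1) := by
    rw [add_assoc ((m + 1 : ℕ) : ℂ) a b, Gamma_add_nat_cpoch ha, Gamma_add_nat_cpoch hb,
      Gamma_add_nat_cpoch hab', uTerm, Nat.factorial_succ]
    have e : Complex.Gamma ((m + 1 : ℕ) : ℂ) = m.factorial := by
      rw [← Complex.Gamma_nat_eq_factorial]; push_cast; rfl
    rw [e]
    have g1 := Complex.Gamma_ne_zero ha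
    have g2 := Complex.Gamma_ne_zero hb
    have g3 := Complex.Gamma_ne_zero hab'
    have g4 := cpoch_ne_zero hab' (m + 1)
    have g5 := fact_ne m
    have g6 := succ_ne m
    push_cast
    field_simp
  rw [hP]
  exact h3
end

section
/- For each positive integer n, the Landau partial sum S_n = ∑_{k=0}^{n-1} ((1/2)_k)^2/(k!)^2 equals (1/π)ψ(n+1) + (γ + 4 log 2)/π + (λ_n/π) ∑_{k=1}^∞ [((1/2)_k)^2/((n+1)_k k!)] · {∑_{r=1}^k 1/(n+r) − σ_k}, where σ_k = ∑_{r=1}^k (2r+1)/((2r−1)r) and λ_n = Γ(n+1/2)^2/(Γ(n)Γ(n+1)). -/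
/-- The Pochhammer (rising factorial) symbol `(x)_k` for real `x`. -/
noncomputable def rpoch (x : ℝ) (k : ℕ) : ℝ := ∏ i ∈ Finset.range k, (x + i)

/-- The digamma function `ψ = Γ'/Γ` on `ℝ`. -/
noncomputable def rdigamma (x : ℝ) : ℝ := deriv Real.Gamma x / Real.Gamma x

/-- The coefficients `σ_k = ∑_{r=1}^k (2r+1)/((2r-1)r)`. -/
noncomputable def landauSigma (k : ℕ) : ℝ :=
  ∑ r ∈ Finset.Icc 1 k, (2 * (r : ℝ) + 1) / ((2 * (r : ℝ) - 1) * r)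

open Filter Topology

noncomputable def lanp (k : ℕ) : ℝ := rpoch (1 / 2) k

lemma lanp_succ (k : ℕ) : lanp (k + 1) = lanp k * (k + 1 / 2) := by
  simp only [lanp, rpoch, Finset.prod_range_succ]; ring

lemma lanp_zero : lanp 0 = 1 := by simp [lanp, rpoch]

lemma lanp_pos (k : ℕ) : 0 < lanp k := by
  induction k with
  | zero => rw [lanp_zero]; norm_num
  | succ k ih => rw [lanp_succ]; positivity

noncomputable def lanb (n k : ℕ) : ℝ :=
  Real.pi * lanp n ^ 2 * lanp k ^ 2 / (n.factorial * k.factorial * (n + k).factorial)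

lemma lb_succ_left (n k : ℕ) :
    lanb (n + 1) k = lanb n k * ((n + 1 / 2) ^ 2 / ((n + 1) * (n + 1 + k))) := by
  have h : n + 1 + k = (n + k) + 1 := by ring
  unfold lanb
  rw [h, lanp_succ, Nat.factorial_succ, Nat.factorial_succ]
  push_cast
  have : (n : ℝ) + k + 1 ≠ 0 := by positivity
  have : (n : ℝ) + 1 + k ≠ 0 := by positivity
  field_simp
  ring

lemma lb_succ_right (n k : ℕ) :
    lanb n (k + 1) = lanb n k * ((k + 1 / 2) ^ 2 / ((k + 1) * (n + 1 + k))) := by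
  have h : n + (k + 1) = (n + k) + 1 := by ring
  unfold lanb
  rw [h, lanp_succ, Nat.factorial_succ, Nat.factorial_succ]
  push_cast
  have : (n : ℝ) + k + 1 ≠ 0 := by positivity
  have : (n : ℝ) + 1 + k ≠ 0 := by positivity
  field_simp
  ring

noncomputable def lanl (n k : ℕ) : ℝ :=
  (harmonic (n + k) : ℝ) + 4 * Real.log 2 - landauSigma k

lemma sigma_succ (k : ℕ) :
    landauSigma (k + 1) = landauSigma k + (2 * (k : ℝ) + 3) / ((2 * (k : ℝ) + 1) * (k + 1)) := by
  unfold landauSigma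
  rw [Finset.sum_Icc_succ_top (by omega)]
  push_cast
  congr 2 <;> ring

lemma sigma_zero : landauSigma 0 = 0 := by simp [landauSigma]

lemma harm_succ (n : ℕ) : (harmonic (n + 1) : ℝ) = harmonic n + 1 / ((n : ℝ) + 1) := by
  rw [harmonic_succ]; push_cast; simp

lemma sigma_eq (k : ℕ) : landauSigma k = 4 * (harmonic (2 * k) : ℝ) - 3 * harmonic k := by
  induction k with
  | zero => simp [sigma_zero]
  | succ k ih =>
    rw [sigma_succ, ih, show 2 * (k + 1) = 2 * k + 1 + 1 by ring, harm_succ, harm_succ, harm_succ]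
    push_cast
    have : 2 * (k : ℝ) + 1 ≠ 0 := by positivity
    have : 2 * (k : ℝ) + 1 + 1 ≠ 0 := by positivity
    have : (k : ℝ) + 1 ≠ 0 := by positivity
    field_simp
    ring

lemma ll_succ_left (n k : ℕ) : lanl (n + 1) k = lanl n k + 1 / ((n : ℝ) + k + 1) := by
  unfold lanl
  rw [show n + 1 + k = (n + k) + 1 by ring, harm_succ]
  push_cast
  ring

lemma ll_succ_right (n k : ℕ) : lanl n (k + 1) = lanl n k + 1 / ((n : ℝ) + k + 1)
    - (2 * (k : ℝ) + 3) / ((2 * (k : ℝ) + 1) * (k + 1)) := by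
  unfold lanl
  rw [show n + (k + 1) = (n + k) + 1 by ring, harm_succ, sigma_succ]
  push_cast
  ring

lemma sum_one (n K : ℕ) :
    ∑ k ∈ Finset.range K, ((n : ℝ) + 1) * lanb (n + 1) k
      = ∑ k ∈ Finset.range K, (n : ℝ) * lanb n k + K * lanb n K := by
  induction K with
  | zero => simp
  | succ K ih =>
    rw [Finset.sum_range_succ, Finset.sum_range_succ, ih, lb_succ_left, lb_succ_right]
    push_cast
    have : (n : ℝ) + 1 + K ≠ 0 := by positivity
    have : (n : ℝ) + 1 ≠ 0 := by positivity
    have : (K : ℝ) + 1 ≠ 0 := by positivity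
    field_simp
    ring

lemma sum_two (n K : ℕ) :
    ∑ k ∈ Finset.range K, ((n : ℝ) + 1) * lanb (n + 1) k * lanl (n + 1) k
      = ∑ k ∈ Finset.range K, (n : ℝ) * lanb n k * lanl n k
        + (K * lanl n K - 1) * lanb n K + lanb n 0 := by
  induction K with
  | zero => simp
  | succ K ih =>
    rw [Finset.sum_range_succ, Finset.sum_range_succ, ih, lb_succ_left, lb_succ_right,
      ll_succ_left, ll_succ_right]
    push_cast
    have : (n : ℝ) + 1 + K ≠ 0 := by positivity
    have : (n : ℝ) + K + 1 ≠ 0 := by positivity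
    have : (n : ℝ) + 1 ≠ 0 := by positivity
    have : (K : ℝ) + 1 ≠ 0 := by positivity
    have : 2 * (K : ℝ) + 1 ≠ 0 := by positivity
    field_simp
    ring

lemma tendsto_ll (n : ℕ) : Tendsto (lanl n) atTop (𝓝 0) := by
  induction n with
  | zero =>
    have h1 := Real.tendsto_harmonic_sub_log
    have h2 : Tendsto (fun k : ℕ => 2 * k) atTop atTop :=
      tendsto_id.const_mul_atTop' (by norm_num)
    have h3 := h1.comp h2
    have h4 := (h1.const_mul 4).sub (h3.const_mul 4)
    rw [sub_self] at h4
    refine h4.congr' ?_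
    filter_upwards [eventually_gt_atTop 0] with k hk
    have hk' : (k : ℝ) ≠ 0 := by positivity
    simp only [Function.comp, lanl, sigma_eq, zero_add]
    push_cast
    rw [Real.log_mul two_ne_zero hk']
    ring
  | succ n ih =>
    have h : Tendsto (fun k : ℕ => 1 / ((n : ℝ) + k + 1)) atTop (𝓝 0) := by
      have := (tendsto_one_div_add_atTop_nhds_zero_nat (𝕜 := ℝ)).comp (tendsto_add_atTop_nat n)
      refine this.congr fun k => ?_
      simp only [Function.comp]
      push_cast
      ring_nf
    have := ih.add h
    rw [add_zero] at this
    exact this.congr fun k => (ll_succ_left n k).symm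

lemma wallis_eq (K : ℕ) :
    Real.Wallis.W K * ((2 * K + 1) * lanp K ^ 2) = (K.factorial : ℝ) ^ 2 := by
  induction K with
  | zero => simp [Real.Wallis.W, lanp_zero]
  | succ K ih =>
    rw [Real.Wallis.W_succ, lanp_succ, Nat.factorial_succ]
    push_cast
    rw [mul_pow ((K : ℝ) + 1), ← ih]
    have : 2 * (K : ℝ) + 1 ≠ 0 := by positivity
    have : 2 * (K : ℝ) + 3 ≠ 0 := by positivity
    field_simp
    ring

lemma tendsto_klb_zero : Tendsto (fun K : ℕ => (K : ℝ) * lanb 0 K) atTop (𝓝 1) := by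
  have h1 := Real.Wallis.tendsto_W_nhds_pi_div_two
  have h2 : Tendsto (fun K : ℕ => (1 - 1 / ((((2 * K : ℕ) : ℝ)) + 1)) * (Real.pi / 2)) atTop
      (𝓝 ((1 - 0) * (Real.pi / 2))) := by
    refine Tendsto.mul_const _ (Tendsto.const_sub _ ?_)
    exact (tendsto_one_div_add_atTop_nhds_zero_nat (𝕜 := ℝ)).comp
      (tendsto_id.const_mul_atTop' (by norm_num : 0 < 2))
  have h3 := h2.div h1 (by positivity)
  rw [sub_zero, one_mul, div_self (by positivity)] at h3
  refine h3.congr fun K => ?_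
  have hW : Real.Wallis.W K ≠ 0 := (Real.Wallis.W_pos K).ne'
  have hl : lanp K ≠ 0 := (lanp_pos K).ne'
  simp only [lanb, zero_add, lanp_zero, Pi.div_apply]
  have e := wallis_eq K
  have : 2 * (K : ℝ) + 1 ≠ 0 := by positivity
  rw [show ((Nat.factorial 0 : ℕ) : ℝ) * K.factorial * K.factorial = (K.factorial : ℝ) ^ 2 by
    simp; ring, ← e]
  push_cast
  field_simp
  ring

lemma lan_tendsto_inv (n : ℕ) (c : ℝ) :
    Tendsto (fun K : ℕ => c / (((n : ℝ) + 1) * (n + 1 + K))) atTop (𝓝 0) := by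
  refine Tendsto.const_div_atTop ?_ c
  refine Tendsto.const_mul_atTop (by positivity) ?_
  exact tendsto_atTop_add_const_left _ _ tendsto_natCast_atTop_atTop

lemma tendsto_klb_succ (n : ℕ) : Tendsto (fun K : ℕ => (K : ℝ) * lanb (n + 1) K) atTop (𝓝 0) := by
  have key : ∀ m : ℕ, ∀ c : ℝ, Tendsto (fun K : ℕ => (K : ℝ) * lanb m K) atTop (𝓝 c) →
      Tendsto (fun K : ℕ => (K : ℝ) * lanb (m + 1) K) atTop (𝓝 0) := by
    intro m c h
    have := h.mul (lan_tendsto_inv m (((m : ℝ) + 1 / 2) ^ 2))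
    rw [mul_zero] at this
    refine this.congr fun K => ?_
    rw [lb_succ_left]; ring
  induction n with
  | zero => exact key 0 1 tendsto_klb_zero
  | succ n ih => exact key _ 0 ih

lemma tendsto_lb_of {n : ℕ} {c : ℝ} (h : Tendsto (fun K : ℕ => (K : ℝ) * lanb n K) atTop (𝓝 c)) :
    Tendsto (fun K : ℕ => lanb n K) atTop (𝓝 0) := by
  have := h.mul (tendsto_inv_atTop_nhds_zero_nat (𝕜 := ℝ))
  rw [mul_zero] at this
  refine this.congr' ?_
  filter_upwards [eventually_gt_atTop 0] with k hk
  have hk' : (k : ℝ) ≠ 0 := by positivity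
  field_simp

lemma exists_klb (n : ℕ) : ∃ c, Tendsto (fun K : ℕ => (K : ℝ) * lanb n K) atTop (𝓝 c) := by
  cases n with
  | zero => exact ⟨1, tendsto_klb_zero⟩
  | succ n => exact ⟨0, tendsto_klb_succ n⟩

lemma lim_one (n : ℕ) :
    Tendsto (fun K => ∑ k ∈ Finset.range K, ((n : ℝ) + 1) * lanb (n + 1) k) atTop (𝓝 1) := by
  induction n with
  | zero =>
    refine tendsto_klb_zero.congr fun K => ?_
    rw [sum_one]; simp
  | succ n ih =>
    have := ih.add (tendsto_klb_succ n)
    rw [add_zero] at this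
    refine this.congr fun K => ?_
    rw [sum_one (n + 1)]; push_cast; rfl

lemma lim_two (n : ℕ) :
    Tendsto (fun K => ∑ k ∈ Finset.range K, (n : ℝ) * lanb n k * lanl n k) atTop
      (𝓝 (∑ k ∈ Finset.range n, lanb k 0)) := by
  induction n with
  | zero => simp
  | succ n ih =>
    obtain ⟨c, hc⟩ := exists_klb n
    have h := (ih.add ((hc.mul (tendsto_ll n)).sub (tendsto_lb_of hc))).add_const (lanb n 0)
    rw [mul_zero, sub_zero, add_zero, ← Finset.sum_range_succ] at h
    refine h.congr fun K => ?_
    push_cast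
    rw [sum_two]; ring

lemma gamma_half (n : ℕ) : Real.Gamma ((n : ℝ) + 1 / 2) = lanp n * √Real.pi := by
  induction n with
  | zero => simp [lanp_zero, Real.Gamma_one_half_eq, ← one_div]
  | succ n ih =>
    push_cast
    rw [show (n : ℝ) + 1 + 1 / 2 = (n + 1 / 2) + 1 by ring,
      Real.Gamma_add_one (by positivity), ih, lanp_succ]
    ring

lemma rpoch_nat (n k : ℕ) :
    rpoch ((n : ℝ) + 1) k * n.factorial = (n + k).factorial := by
  induction k with
  | zero => simp [rpoch]
  | succ k ih =>
    have : rpoch ((n : ℝ) + 1) (k + 1) = rpoch ((n : ℝ) + 1) k * (n + 1 + k) := by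
      simp [rpoch, Finset.prod_range_succ]
    rw [this, show n + (k + 1) = (n + k) + 1 by ring, Nat.factorial_succ]
    push_cast
    rw [← ih]; ring

lemma brace_eq (n k : ℕ) :
    (∑ r ∈ Finset.Icc 1 k, 1 / ((n : ℝ) + r)) - landauSigma k = lanl n k - lanl n 0 := by
  induction k with
  | zero => simp [sigma_zero]
  | succ k ih =>
    rw [Finset.sum_Icc_succ_top (by omega), sigma_succ, ll_succ_right]
    push_cast
    rw [← add_assoc]
    linarith

lemma brace_nonpos (n k : ℕ) : lanl n k - lanl n 0 ≤ 0 := by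
  induction k with
  | zero => simp
  | succ k ih =>
    rw [ll_succ_right]
    have : 1 / ((n : ℝ) + k + 1) ≤ (2 * (k : ℝ) + 3) / ((2 * (k : ℝ) + 1) * (k + 1)) := by
      rw [div_le_div_iff₀ (by positivity) (by positivity)]
      have : (0 : ℝ) ≤ n := by positivity
      have : (0 : ℝ) ≤ k := by positivity
      nlinarith [mul_nonneg ‹(0 : ℝ) ≤ n› ‹(0 : ℝ) ≤ k›]
    linarith

lemma lb_pos (n k : ℕ) : 0 < lanb n k := by
  have := lanp_pos n
  have := lanp_pos k
  unfold lanb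
  positivity

lemma hasSum_main (m : ℕ) :
    HasSum (fun k : ℕ => ((m : ℝ) + 1) * lanb (m + 1) (k + 1) * (lanl (m + 1) (k + 1) - lanl (m + 1) 0))
      (∑ k ∈ Finset.range (m + 1), lanb k 0 - lanl (m + 1) 0) := by
  have h : HasSum (fun k : ℕ => -(((m : ℝ) + 1) * lanb (m + 1) k * (lanl (m + 1) k - lanl (m + 1) 0)))
      (-(∑ k ∈ Finset.range (m + 1), lanb k 0 - lanl (m + 1) 0)) := by
    rw [hasSum_iff_tendsto_nat_of_nonneg]
    · have := ((lim_two (m + 1)).sub ((lim_one m).mul_const (lanl (m + 1) 0))).neg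
      rw [one_mul] at this
      refine this.congr fun K => ?_
      rw [Finset.sum_mul, ← Finset.sum_sub_distrib, ← Finset.sum_neg_distrib]
      refine Finset.sum_congr rfl fun k _ => ?_
      push_cast
      ring
    · intro k
      have h1 := brace_nonpos (m + 1) k
      have h2 := lb_pos (m + 1) k
      have h3 : 0 ≤ ((m : ℝ) + 1) * lanb (m + 1) k := by positivity
      nlinarith [mul_nonneg h3 (neg_nonneg.2 h1)]
  have h' := h.neg
  simp only [neg_neg] at h'
  rw [← hasSum_nat_add_iff' 1] at h'
  simpa using h'

/-- The rearranged convergent expansion for the Landau partial sums: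
`S_n = ψ(n+1)/π + (γ + 4 log 2)/π
  + (λ_n/π) ∑_{k=1}^∞ ((1/2)_k)²/((n+1)_k k!)·{∑_{r=1}^k 1/(n+r) − σ_k}`. -/
theorem landau_rearranged_expansion (n : ℕ) (hn : 0 < n) :
    ∑ k ∈ Finset.range n, (rpoch (1 / 2) k) ^ 2 / (Nat.factorial k : ℝ) ^ 2
      = (1 / Real.pi) * rdigamma ((n : ℝ) + 1)
        + (Real.eulerMascheroniConstant + 4 * Real.log 2) / Real.pi
        + Real.Gamma ((n : ℝ) + 1 / 2) ^ 2 / (Real.Gamma n * Real.Gamma ((n : ℝ) + 1)) / Real.pi *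
          ∑' k : ℕ, (rpoch (1 / 2) (k + 1)) ^ 2 /
              (rpoch ((n : ℝ) + 1) (k + 1) * (Nat.factorial (k + 1) : ℝ)) *
            ((∑ r ∈ Finset.Icc 1 (k + 1), 1 / ((n : ℝ) + r)) - landauSigma (k + 1)) := by
  obtain ⟨m, rfl⟩ : ∃ m, n = m + 1 := ⟨n - 1, by omega⟩
  have hpi := Real.pi_pos
  have hS : ∑ k ∈ Finset.range (m + 1), lanb k 0 = Real.pi *
      ∑ k ∈ Finset.range (m + 1), (rpoch (1 / 2) k) ^ 2 / (Nat.factorial k : ℝ) ^ 2 := by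
    rw [Finset.mul_sum]
    refine Finset.sum_congr rfl fun k _ => ?_
    have : lanp k = rpoch (1 / 2) k := rfl
    simp only [lanb, lanp_zero, ← this, add_zero, Nat.factorial_zero]
    push_cast
    field_simp
  have hpsi : rdigamma (((m + 1 : ℕ) : ℝ) + 1) + Real.eulerMascheroniConstant + 4 * Real.log 2
      = lanl (m + 1) 0 := by
    unfold rdigamma lanl
    rw [Real.deriv_Gamma_nat, Real.Gamma_nat_eq_factorial, sigma_zero, add_zero]
    have : ((m + 1).factorial : ℝ) ≠ 0 := by positivity
    field_simp
    ring
  have hT : Real.Gamma (((m + 1 : ℕ) : ℝ) + 1 / 2) ^ 2 /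
        (Real.Gamma ((m + 1 : ℕ) : ℝ) * Real.Gamma (((m + 1 : ℕ) : ℝ) + 1)) *
          ∑' k : ℕ, (rpoch (1 / 2) (k + 1)) ^ 2 /
              (rpoch (((m + 1 : ℕ) : ℝ) + 1) (k + 1) * (Nat.factorial (k + 1) : ℝ)) *
            ((∑ r ∈ Finset.Icc 1 (k + 1), 1 / (((m + 1 : ℕ) : ℝ) + r)) - landauSigma (k + 1))
      = ∑ k ∈ Finset.range (m + 1), lanb k 0 - lanl (m + 1) 0 := by
    rw [← (hasSum_main m).tsum_eq, ← tsum_mul_left]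
    congr 1
    funext k
    rw [brace_eq, ← mul_assoc]
    congr 1
    rw [gamma_half, Real.Gamma_nat_eq_factorial]
    have h1 : Real.Gamma ((m + 1 : ℕ) : ℝ) = m.factorial := by
      push_cast
      exact Real.Gamma_nat_eq_factorial m
    have h2 := rpoch_nat (m + 1) (k + 1)
    have h0 : ((m + 1).factorial : ℝ) ≠ 0 := by positivity
    have h3 : rpoch (((m + 1 : ℕ) : ℝ) + 1) (k + 1)
        = ((m + 1 + (k + 1)).factorial : ℝ) / (m + 1).factorial := by
      rw [← h2]; field_simp
    have h4 : ((m + 1).factorial : ℝ) = (m + 1) * m.factorial := by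
      rw [Nat.factorial_succ]; push_cast; ring
    have h5 : lanp (k + 1) = rpoch (1 / 2) (k + 1) := rfl
    rw [h1, h3, mul_pow, Real.sq_sqrt hpi.le, ← h5]
    unfold lanb
    rw [h4]
    have : (m : ℝ) + 1 ≠ 0 := by positivity
    field_simp
  have hT' := hT
  rw [div_mul_eq_mul_div (_ / _) Real.pi, hT, hS, ← hpsi]
  field_simp
  ring
end

section
/- The partial sums S_n = ∑_{k=0}^{n-1} ((1/2)_k)^2/(k!)^2 of the Landau series satisfy S_n − (1/π) log n → (γ + 4 log 2)/π as n → ∞; in particular S_n ∼ (1/π) log n. -/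
lemma lc_succ (k : ℕ) : rpoch (1 / 2) (k + 1) / (Nat.factorial (k + 1) : ℝ)
    = (rpoch (1 / 2) k / (Nat.factorial k : ℝ)) * ((2 * (k : ℝ) + 1) / (2 * k + 2)) := by
  have h : (Nat.factorial k : ℝ) ≠ 0 := by positivity
  rw [rpoch, Finset.prod_range_succ, ← rpoch, Nat.factorial_succ]
  push_cast
  field_simp
  ring

/-- The coefficient `(1/2)_k / k!`. -/
noncomputable def lc (k : ℕ) : ℝ := rpoch (1 / 2) k / (Nat.factorial k : ℝ)

lemma lc_zero : lc 0 = 1 := by simp [lc, rpoch]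

lemma lc_succ' (k : ℕ) : lc (k + 1) = lc k * ((2 * (k : ℝ) + 1) / (2 * k + 2)) := lc_succ k

lemma lc_pos (k : ℕ) : 0 < lc k := by
  induction k with
  | zero => simp [lc_zero]
  | succ k ih => rw [lc_succ']; positivity

lemma lc_eq_prod (k : ℕ) : lc k = ∏ i ∈ Finset.range k, (2 * (i : ℝ) + 1) / (2 * i + 2) := by
  induction k with
  | zero => simp [lc_zero]
  | succ k ih => rw [lc_succ', Finset.prod_range_succ, ih]

lemma lc_even (k : ℕ) : (∫ x in (0 : ℝ)..Real.pi, Real.sin x ^ (2 * k)) = Real.pi * lc k := by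
  rw [integral_sin_pow_even, lc_eq_prod]

lemma lc_odd (k : ℕ) :
    lc k * (∫ x in (0 : ℝ)..Real.pi, Real.sin x ^ (2 * k + 1)) = 2 / (2 * k + 1) := by
  rw [integral_sin_pow_odd]
  induction k with
  | zero => simp [lc_zero]
  | succ k ih =>
    rw [lc_succ', Finset.prod_range_succ]
    have : lc k * ((2 * (k : ℝ) + 1) / (2 * k + 2)) *
        (2 * ((∏ i ∈ Finset.range k, (2 * (i : ℝ) + 2) / (2 * i + 3))
          * ((2 * (k : ℝ) + 2) / (2 * k + 3))))
        = (lc k * (2 * ∏ i ∈ Finset.range k, (2 * (i : ℝ) + 2) / (2 * i + 3)))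
          * (((2 * (k : ℝ) + 1) / (2 * k + 2)) * ((2 * (k : ℝ) + 2) / (2 * k + 3))) := by ring
    rw [this, ih]
    push_cast
    field_simp
    ring

lemma lc_sq (k : ℕ) : lc k ^ 2 = (1 / Real.pi) * (2 / (2 * k + 1))
    + (1 / Real.pi) * ∫ x in (0 : ℝ)..Real.pi,
        lc k * Real.sin x ^ (2 * k) * (1 - Real.sin x) := by
  have h1 : (∫ x in (0 : ℝ)..Real.pi, lc k * Real.sin x ^ (2 * k) * (1 - Real.sin x))
      = lc k * (∫ x in (0 : ℝ)..Real.pi, Real.sin x ^ (2 * k))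
        - lc k * (∫ x in (0 : ℝ)..Real.pi, Real.sin x ^ (2 * k + 1)) := by
    rw [← intervalIntegral.integral_const_mul, ← intervalIntegral.integral_const_mul,
      ← intervalIntegral.integral_sub]
    · congr 1
      ext x
      ring
    · exact Continuous.intervalIntegrable (by fun_prop) _ _
    · exact Continuous.intervalIntegrable (by fun_prop) _ _
  rw [h1, lc_odd, lc_even]
  have := Real.pi_ne_zero
  field_simp
  ring

lemma lc_choose (k : ℕ) : Ring.choose ((1 / 2 : ℝ) + k - 1) k = lc k := by
  rw [← Ring.multichoose_eq]
  have h := Ring.factorial_nsmul_multichoose_eq_ascPochhammer (1 / 2 : ℝ) k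
  have h0 : (Nat.factorial k : ℝ) ≠ 0 := by positivity
  have h2 : ∀ k, Polynomial.smeval (ascPochhammer ℕ k) (1 / 2 : ℝ) = rpoch (1 / 2) k := by
    intro k
    rw [Polynomial.ascPochhammer_smeval_eq_eval]
    induction k with
    | zero => simp [rpoch]
    | succ k ih =>
      rw [ascPochhammer_succ_eval, ih]
      simp [rpoch, Finset.prod_range_succ]
  rw [h2, nsmul_eq_mul] at h
  rw [lc, ← h]
  field_simp

lemma lc_hasSum (y : ℝ) (hy : |y| < 1) :
    HasSum (fun k => lc k * y ^ k) (1 / Real.sqrt (1 - y)) := by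
  have h := (Real.one_div_one_sub_rpow_hasFPowerSeriesOnBall_zero (1 / 2)).hasSum
    (y := y) (by simpa [Metric.mem_eball, edist_eq_enorm_sub, ← ofReal_norm] using hy)
  simp only [FormalMultilinearSeries.ofScalars_apply_eq, lc_choose, zero_add] at h
  rw [Real.sqrt_eq_rpow]
  simpa [smul_eq_mul] using h

lemma lc_pointwise (x : ℝ) (h0 : 0 ≤ Real.sin x) (h1 : Real.sin x < 1) :
    HasSum (fun k => lc k * Real.sin x ^ (2 * k) * (1 - Real.sin x))
      (|Real.cos x| / (1 + Real.sin x)) := by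
  have hs : Real.sin x ^ 2 < 1 := by nlinarith
  have h := (lc_hasSum (Real.sin x ^ 2) (by rw [abs_of_nonneg (sq_nonneg _)]; exact hs)).mul_right
    (1 - Real.sin x)
  have hc : 0 < |Real.cos x| := by
    rw [abs_pos]; intro hc
    have := Real.sin_sq_add_cos_sq x
    rw [hc] at this
    nlinarith
  have h' : HasSum (fun k => lc k * Real.sin x ^ (2 * k) * (1 - Real.sin x))
      (1 / Real.sqrt (1 - Real.sin x ^ 2) * (1 - Real.sin x)) := by
    simpa only [pow_mul] using h
  have e : |Real.cos x| / (1 + Real.sin x)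
      = 1 / Real.sqrt (1 - Real.sin x ^ 2) * (1 - Real.sin x) := by
    rw [← Real.cos_sq', Real.sqrt_sq_eq_abs]
    have : |Real.cos x| ^ 2 = (1 - Real.sin x) * (1 + Real.sin x) := by
      rw [sq_abs, Real.cos_sq']; ring
    field_simp
    rw [this]
    ring
  rw [e]
  exact h'

open Filter Topology MeasureTheory in
lemma lc_tendsto_integral :
    Tendsto (fun n : ℕ => ∑ k ∈ Finset.range n, ∫ x in (0 : ℝ)..Real.pi,
        lc k * Real.sin x ^ (2 * k) * (1 - Real.sin x)) atTop
      (𝓝 (∫ x in (0 : ℝ)..Real.pi, |Real.cos x| / (1 + Real.sin x))) := by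
  have hae : ∀ᵐ x : ℝ ∂volume, x ∈ Set.uIoc 0 Real.pi →
      0 ≤ Real.sin x ∧ Real.sin x < 1 := by
    have : ∀ᵐ x : ℝ ∂volume, x ≠ Real.pi / 2 := by
      simp [ae_iff, measure_singleton]
    filter_upwards [this] with x hx hxm
    rw [Set.uIoc_of_le Real.pi_pos.le] at hxm
    refine ⟨Real.sin_nonneg_of_nonneg_of_le_pi hxm.1.le hxm.2, ?_⟩
    refine lt_of_le_of_ne (Real.sin_le_one x) fun h => hx ?_
    have hc : Real.cos x = 0 := by
      have := Real.sin_sq_add_cos_sq x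
      rw [h] at this
      nlinarith
    refine Real.injOn_cos ⟨hxm.1.le, hxm.2⟩ ⟨by positivity, by linarith [Real.pi_pos]⟩ ?_
    rw [hc, Real.cos_pi_div_two]
  have key : Tendsto (fun n : ℕ => ∫ x in (0 : ℝ)..Real.pi, ∑ k ∈ Finset.range n,
        lc k * Real.sin x ^ (2 * k) * (1 - Real.sin x)) atTop
      (𝓝 (∫ x in (0 : ℝ)..Real.pi, |Real.cos x| / (1 + Real.sin x))) := by
    refine intervalIntegral.tendsto_integral_filter_of_dominated_convergence (fun _ => (1 : ℝ))
      ?_ ?_ ?_ ?_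
    · refine Eventually.of_forall fun n => Continuous.aestronglyMeasurable ?_
      fun_prop
    · refine Eventually.of_forall fun n => ?_
      filter_upwards [hae] with x hx hxm
      obtain ⟨h0, h1⟩ := hx hxm
      have hn : ∀ k, 0 ≤ lc k * Real.sin x ^ (2 * k) * (1 - Real.sin x) := fun k =>
        mul_nonneg (mul_nonneg (lc_pos k).le (pow_nonneg h0 _)) (by linarith)
      rw [Real.norm_of_nonneg (Finset.sum_nonneg fun k _ => hn k)]
      refine (sum_le_hasSum _ (fun k _ => hn k) (lc_pointwise x h0 h1)).trans ?_
      rw [div_le_one (by linarith)]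
      linarith [Real.abs_cos_le_one x]
    · exact intervalIntegrable_const
    · filter_upwards [hae] with x hx hxm
      obtain ⟨h0, h1⟩ := hx hxm
      exact (lc_pointwise x h0 h1).tendsto_sum_nat
  refine key.congr fun n => ?_
  rw [intervalIntegral.integral_finsetSum]
  intro k _
  exact Continuous.intervalIntegrable (by fun_prop) _ _

lemma lc_integral_part (a b : ℝ) (ha : 0 ≤ a) (hab : a ≤ b) (hb : b ≤ Real.pi) :
    (∫ x in a..b, Real.cos x / (1 + Real.sin x))
      = Real.log (1 + Real.sin b) - Real.log (1 + Real.sin a) := by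
  have hp : ∀ x ∈ Set.uIcc a b, 1 + Real.sin x ≠ 0 := by
    intro x hx
    rw [Set.uIcc_of_le hab] at hx
    have := Real.sin_nonneg_of_nonneg_of_le_pi (ha.trans hx.1) (hx.2.trans hb)
    linarith
  refine intervalIntegral.integral_eq_sub_of_hasDerivAt
    (f := fun x => Real.log (1 + Real.sin x)) ?_ ?_
  · intro x hx
    exact ((Real.hasDerivAt_sin x).const_add 1).log (hp x hx)
  · refine ContinuousOn.intervalIntegrable ?_
    exact ContinuousOn.div (by fun_prop) (by fun_prop) hp

lemma lc_integral :
    (∫ x in (0 : ℝ)..Real.pi, |Real.cos x| / (1 + Real.sin x)) = 2 * Real.log 2 := by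
  have hpi := Real.pi_pos
  have hcont : ∀ a b : ℝ, 0 ≤ a → a ≤ b → b ≤ Real.pi →
      IntervalIntegrable (fun x => |Real.cos x| / (1 + Real.sin x)) MeasureTheory.volume a b := by
    intro a b ha hab hb
    refine ContinuousOn.intervalIntegrable ?_
    refine ContinuousOn.div (by fun_prop) (by fun_prop) ?_
    intro x hx
    rw [Set.uIcc_of_le hab] at hx
    have := Real.sin_nonneg_of_nonneg_of_le_pi (ha.trans hx.1) (hx.2.trans hb)
    linarith
  rw [← intervalIntegral.integral_add_adjacent_intervals (b := Real.pi / 2)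
    (hcont _ _ le_rfl (by linarith) (by linarith))
    (hcont _ _ (by linarith) (by linarith) le_rfl)]
  have e1 : (∫ x in (0 : ℝ)..(Real.pi / 2), |Real.cos x| / (1 + Real.sin x))
      = ∫ x in (0 : ℝ)..(Real.pi / 2), Real.cos x / (1 + Real.sin x) := by
    refine intervalIntegral.integral_congr fun x hx => ?_
    rw [Set.uIcc_of_le (by linarith)] at hx
    rw [abs_of_nonneg (Real.cos_nonneg_of_mem_Icc ⟨by linarith [hx.1], hx.2⟩)]
  have e2 : (∫ x in (Real.pi / 2)..Real.pi, |Real.cos x| / (1 + Real.sin x))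
      = ∫ x in (Real.pi / 2)..Real.pi, -(Real.cos x / (1 + Real.sin x)) := by
    refine intervalIntegral.integral_congr fun x hx => ?_
    rw [Set.uIcc_of_le (by linarith)] at hx
    rw [abs_of_nonpos (Real.cos_nonpos_of_pi_div_two_le_of_le hx.1 (by linarith [hx.2])), neg_div]
  rw [e1, e2, intervalIntegral.integral_neg, lc_integral_part _ _ le_rfl (by linarith) (by linarith),
    lc_integral_part _ _ (by linarith) (by linarith) le_rfl]
  norm_num
  ring

lemma odd_harmonic (n : ℕ) : (∑ k ∈ Finset.range n, 2 / (2 * (k : ℝ) + 1))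
    = 2 * (harmonic (2 * n) : ℝ) - (harmonic n : ℝ) := by
  induction n with
  | zero => simp
  | succ n ih =>
    rw [Finset.sum_range_succ, ih, show 2 * (n + 1) = 2 * n + 1 + 1 by ring, harmonic_succ,
      harmonic_succ, harmonic_succ]
    push_cast
    field_simp
    ring

open Filter Topology in
lemma tendsto_odd_harmonic :
    Tendsto (fun n : ℕ => (∑ k ∈ Finset.range n, 2 / (2 * (k : ℝ) + 1)) - Real.log n) atTop
      (𝓝 (Real.eulerMascheroniConstant + 2 * Real.log 2)) := by
  have h1 := Real.tendsto_harmonic_sub_log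
  have h2 := h1.comp (tendsto_id.const_mul_atTop' (show 0 < 2 by norm_num) :
    Tendsto (fun n : ℕ => 2 * n) atTop atTop)
  have h3 := ((h2.const_mul 2).sub h1).add_const (2 * Real.log 2)
  have e : 2 * Real.eulerMascheroniConstant - Real.eulerMascheroniConstant + 2 * Real.log 2
      = Real.eulerMascheroniConstant + 2 * Real.log 2 := by ring
  rw [e] at h3
  refine h3.congr' ?_
  filter_upwards [eventually_ne_atTop 0] with n hn
  have hn' : (n : ℝ) ≠ 0 := by exact_mod_cast hn
  rw [odd_harmonic]
  simp only [Function.comp]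
  push_cast
  rw [Real.log_mul (by norm_num) hn']
  ring

/-- Landau's asymptotic with constant term:
`S_n − (1/π) log n → (γ + 4 log 2)/π`, and in particular `S_n ∼ (1/π) log n`. -/
theorem landau_partial_sum_asymptotic :
    Filter.Tendsto
      (fun n : ℕ =>
        (∑ k ∈ Finset.range n, (rpoch (1 / 2) k) ^ 2 / (Nat.factorial k : ℝ) ^ 2)
          - (1 / Real.pi) * Real.log n)
      Filter.atTop
      (nhds ((Real.eulerMascheroniConstant + 4 * Real.log 2) / Real.pi)) ∧
    Filter.Tendsto
      (fun n : ℕ =>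
        (∑ k ∈ Finset.range n, (rpoch (1 / 2) k) ^ 2 / (Nat.factorial k : ℝ) ^ 2)
          / Real.log n)
      Filter.atTop (nhds (1 / Real.pi)) := by
  have main : Filter.Tendsto
      (fun n : ℕ =>
        (∑ k ∈ Finset.range n, (rpoch (1 / 2) k) ^ 2 / (Nat.factorial k : ℝ) ^ 2)
          - (1 / Real.pi) * Real.log n)
      Filter.atTop
      (nhds ((Real.eulerMascheroniConstant + 4 * Real.log 2) / Real.pi)) := by
    have h1 := lc_tendsto_integral
    rw [lc_integral] at h1
    have h := (tendsto_odd_harmonic.add h1).const_mul (1 / Real.pi)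
    have e : 1 / Real.pi * (Real.eulerMascheroniConstant + 2 * Real.log 2 + 2 * Real.log 2)
        = (Real.eulerMascheroniConstant + 4 * Real.log 2) / Real.pi := by ring
    rw [e] at h
    refine h.congr fun n => ?_
    have hs : (∑ k ∈ Finset.range n, (rpoch (1 / 2) k) ^ 2 / (Nat.factorial k : ℝ) ^ 2)
        = ∑ k ∈ Finset.range n, lc k ^ 2 := by
      refine Finset.sum_congr rfl fun k _ => ?_
      rw [lc, div_pow]
    rw [hs, Finset.sum_congr rfl fun k _ => lc_sq k, Finset.sum_add_distrib, ← Finset.mul_sum,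
      ← Finset.mul_sum]
    ring
  refine ⟨main, ?_⟩
  have hlog : Filter.Tendsto (fun n : ℕ => Real.log n) Filter.atTop Filter.atTop :=
    Real.tendsto_log_atTop.comp tendsto_natCast_atTop_atTop
  have h := (main.div_atTop hlog).add_const (1 / Real.pi)
  rw [zero_add] at h
  refine h.congr' ?_
  filter_upwards [hlog.eventually_gt_atTop 0] with n hn
  have := hn.ne'
  field_simp
  ring
end
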